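/- Fix t ≥ 0 and h > 0. Let f : ℝⁿ × ℝⁿ × [0,∞) → ℝⁿ satisfy f(0,0,t) = 0 and suppose there is a constant L > 0 such that |f(x,y,t) − f(x',y',t)| ≤ L(|x−x'| + |y−y'|) whenever |x| ∨ |x'| ∨ |y| ∨ |y'| ≤ h. Define the truncated map f_Δ by f_Δ(x,y,t) = f(x,y,t) if |x| ∨ |y| ≤ h, and f_Δ(x,y,t) = ((|x|∨|y|)/h) · f( (h/(|x|∨|y|)) x, (h/(|x|∨|y|)) y, t ) if |x| ∨ |y| > h. Then for all x, y, x̄, ȳ ∈ ℝⁿ, |f_Δ(x,y,t) − f_Δ(x̄,ȳ,t)| ≤ 5L(|x−x̄| + |y−ȳ|). -/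

import Mathlib

/-- Global Lipschitz continuity of the modified truncated coefficient `f_Δ`. -/
theorem truncated_map_global_lipschitz {n : ℕ}
    (t : ℝ) (ht : 0 ≤ t) (h : ℝ) (hh : 0 < h) (L : ℝ) (hL : 0 < L)
    (f : EuclideanSpace ℝ (Fin n) → EuclideanSpace ℝ (Fin n) → ℝ → EuclideanSpace ℝ (Fin n))
    (hf0 : f 0 0 t = 0)
    (hlip : ∀ x x' y y' : EuclideanSpace ℝ (Fin n),
      max (max ‖x‖ ‖x'‖) (max ‖y‖ ‖y'‖) ≤ h →
      ‖f x y t - f x' y' t‖ ≤ L * (‖x - x'‖ + ‖y - y'‖))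
    (fΔ : EuclideanSpace ℝ (Fin n) → EuclideanSpace ℝ (Fin n) → ℝ → EuclideanSpace ℝ (Fin n))
    (hfΔ : ∀ x y, fΔ x y t =
      if max ‖x‖ ‖y‖ ≤ h then f x y t
      else (max ‖x‖ ‖y‖ / h) • f ((h / max ‖x‖ ‖y‖) • x) ((h / max ‖x‖ ‖y‖) • y) t) :
    ∀ x y x' y' : EuclideanSpace ℝ (Fin n),
      ‖fΔ x y t - fΔ x' y' t‖ ≤ 5 * L * (‖x - x'‖ + ‖y - y'‖) := by
  have key : ∀ x y : EuclideanSpace ℝ (Fin n), ∃ (a : ℝ) (u v : EuclideanSpace ℝ (Fin n)),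
      0 < a ∧ a * h = max h (max ‖x‖ ‖y‖) ∧ x = a • u ∧ y = a • v ∧ ‖u‖ ≤ h ∧ ‖v‖ ≤ h ∧
      fΔ x y t = a • f u v t := by
    intro x y
    by_cases hm : max ‖x‖ ‖y‖ ≤ h
    · refine ⟨1, x, y, one_pos, ?_, by simp, by simp, le_trans (le_max_left _ _) hm,
        le_trans (le_max_right _ _) hm, ?_⟩
      · rw [max_eq_left hm, one_mul]
      · rw [hfΔ, if_pos hm, one_smul]
    · have hx : ‖x‖ ≤ max ‖x‖ ‖y‖ := le_max_left _ _
      have hy : ‖y‖ ≤ max ‖x‖ ‖y‖ := le_max_right _ _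
      have hF := hfΔ x y
      rw [if_neg hm] at hF
      generalize max ‖x‖ ‖y‖ = m at *
      push Not at hm
      have hm0 : 0 < m := hh.trans hm
      have e : m / h * (h / m) = 1 := by field_simp
      have hb : ∀ z : EuclideanSpace ℝ (Fin n), ‖z‖ ≤ m → ‖(h / m) • z‖ ≤ h := by
        intro z hz
        rw [norm_smul, Real.norm_of_nonneg (by positivity), div_mul_eq_mul_div, div_le_iff₀ hm0]
        gcongr
      refine ⟨m / h, (h / m) • x, (h / m) • y, by positivity, ?_, ?_, ?_, hb x hx, hb y hy, hF⟩
      · rw [max_eq_right hm.le]; field_simp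
      · rw [smul_smul, e, one_smul]
      · rw [smul_smul, e, one_smul]
  intro x y x' y'
  obtain ⟨a, u, v, ha, ham, hx, hy, hu, hv, hF⟩ := key x y
  obtain ⟨b, u', v', hb, hbm, hx', hy', hu', hv', hF'⟩ := key x' y'
  have hab : |a - b| * h ≤ ‖x - x'‖ + ‖y - y'‖ := by
    have h1 : |a - b| * h = |max h (max ‖x‖ ‖y‖) - max h (max ‖x'‖ ‖y'‖)| := by
      rw [← ham, ← hbm, ← sub_mul, abs_mul, abs_of_pos hh]
    have h2 : |max ‖x‖ ‖y‖ - max ‖x'‖ ‖y'‖| ≤ max |‖x‖ - ‖x'‖| |‖y‖ - ‖y'‖| :=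
      abs_max_sub_max_le_max _ _ _ _
    have h3 := abs_max_sub_max_le_max h (max ‖x‖ ‖y‖) h (max ‖x'‖ ‖y'‖)
    rw [sub_self, abs_zero, max_eq_right (abs_nonneg (max ‖x‖ ‖y‖ - max ‖x'‖ ‖y'‖))] at h3
    have h4 := abs_norm_sub_norm_le x x'
    have h5 := abs_norm_sub_norm_le y y'
    have h6 : max |‖x‖ - ‖x'‖| |‖y‖ - ‖y'‖| ≤ ‖x - x'‖ + ‖y - y'‖ :=
      max_le (by linarith [norm_nonneg (y - y')]) (by linarith [norm_nonneg (x - x')])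
    linarith
  have hS : ∀ z z' w w' : EuclideanSpace ℝ (Fin n), z = a • w → z' = b • w' → ‖w'‖ ≤ h →
      a * ‖w - w'‖ ≤ ‖z - z'‖ + |a - b| * h := by
    intro z z' w w' hz hz' hw'
    have e : a • (w - w') = (z - z') - (a - b) • w' := by
      rw [hz, hz']; module
    calc a * ‖w - w'‖ = ‖a • (w - w')‖ := by rw [norm_smul, Real.norm_of_nonneg ha.le]
      _ ≤ ‖z - z'‖ + ‖(a - b) • w'‖ := by rw [e]; exact norm_sub_le _ _
      _ ≤ _ := by rw [norm_smul, Real.norm_eq_abs]; gcongr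
  have hs1 := hS x x' u u' hx hx' hu'
  have hs2 := hS y y' v v' hy hy' hv'
  have l1 := hlip u u' v v' (max_le (max_le hu hu') (max_le hv hv'))
  have l2 := hlip u' 0 v' 0 (by simp [hu', hv', hh.le])
  rw [hf0, sub_zero, sub_zero, sub_zero] at l2
  have l3 : ‖f u' v' t‖ ≤ L * (h + h) := l2.trans (by gcongr)
  have e : fΔ x y t - fΔ x' y' t = a • (f u v t - f u' v' t) + (a - b) • f u' v' t := by
    rw [hF, hF']; module
  calc ‖fΔ x y t - fΔ x' y' t‖
      ≤ a * ‖f u v t - f u' v' t‖ + |a - b| * ‖f u' v' t‖ := by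
        rw [e]
        refine (norm_add_le _ _).trans ?_
        rw [norm_smul, norm_smul, Real.norm_of_nonneg ha.le, Real.norm_eq_abs]
    _ ≤ a * (L * (‖u - u'‖ + ‖v - v'‖)) + |a - b| * (L * (h + h)) := by gcongr
    _ = L * (a * ‖u - u'‖ + a * ‖v - v'‖ + 2 * (|a - b| * h)) := by ring
    _ ≤ L * (5 * (‖x - x'‖ + ‖y - y'‖)) := by
        apply mul_le_mul_of_nonneg_left _ hL.le
        linarith
    _ = _ := by ring
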